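/- arXiv:0905.0283 — 3 statements merged into one kernel-verified Lean document; each statement's English description precedes it below -/
import Mathlib

section
/- Let (S,d) be a finite metric space, let λ be a real number with λ ≥ 1, and suppose there exists a function c : S → ℝ such that c(v) ≥ 0 for all v ∈ S and d(v,w) ≤ c(v) + c(w) ≤ λ·d(v,w) for all distinct v,w ∈ S. Then for every k ≥ 1 and every sequence of points s_1, t_1, s_2, t_2, …, s_k, t_k in S (with s_{k+1} taken to be s_1), the alternating cycle weight ∑_{j=1}^{k} ( λ·d(s_j, t_j) − d(t_j, s_{j+1}) ) is nonnegative. (This is the statement that feasibility of the linear program implies the parametric graph G(λ) contains no negative-weight cycle.) -/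
theorem Finset.sum_range_succ_mod {M : Type*} [AddCommMonoid M] (f : ℕ → M) (k : ℕ) :
    ∑ j ∈ Finset.range k, f ((j + 1) % k) = ∑ j ∈ Finset.range k, f j := by
  cases k with
  | zero => simp
  | succ n =>
    rw [Finset.sum_range_succ, Finset.sum_range_succ' f, Nat.mod_self]
    congr 1
    refine Finset.sum_congr rfl fun j hj => ?_
    rw [Nat.mod_eq_of_lt (by simpa using hj)]


/-- Feasibility of the star-dilation linear program implies that the parametric
graph `G(λ)` contains no negative-weight cycle: every alternating cycle weight
`∑ (λ·d(s_j,t_j) − d(t_j,s_{j+1}))` (indices mod `k`, with `s_j ≠ t_j` since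
the `λ`-edges of `G(λ)` join distinct points) is nonnegative. -/
theorem star_lp_feasible_implies_no_negative_cycle
    {S : Type*} [Fintype S] [MetricSpace S]
    (lam : ℝ) (hlam : 1 ≤ lam) (c : S → ℝ)
    (hpos : ∀ v : S, 0 ≤ c v)
    (hlow : ∀ v w : S, v ≠ w → dist v w ≤ c v + c w)
    (hhigh : ∀ v w : S, v ≠ w → c v + c w ≤ lam * dist v w)
    (k : ℕ) (hk : 1 ≤ k) (s t : ℕ → S)
    (hst : ∀ j < k, s j ≠ t j) :
    0 ≤ ∑ j ∈ Finset.range k,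
        (lam * dist (s j) (t j) - dist (t j) (s ((j + 1) % k))) := by
  have hdist (v w : S) : dist v w ≤ c v + c w := by
    obtain rfl | hvw := eq_or_ne v w
    · simpa using hpos v
    · exact hlow v w hvw
  calc
    0 = ∑ j ∈ Finset.range k, (c (s j) - c (s ((j + 1) % k))) := by
      rw [Finset.sum_sub_distrib, Finset.sum_range_succ_mod (fun j => c (s j)), sub_self]
    _ ≤ _ := Finset.sum_le_sum fun j hj => by
      linarith [hhigh _ _ (hst j (Finset.mem_range.mp hj)), hdist (t j) (s ((j + 1) % k))]
end

section
/- Let (S,d) be a finite metric space with at least two points and let λ be a real number. Suppose that for every k ≥ 1 and every sequence of points s_1, t_1, s_2, t_2, …, s_k, t_k in S (with s_{k+1} taken to be s_1), the alternating cycle weight ∑_{j=1}^{k} ( λ·d(s_j, t_j) − d(t_j, s_{j+1}) ) is nonnegative. Then there exists a function c : S → ℝ such that c(v) ≥ 0 for all v ∈ S and d(v,w) ≤ c(v) + c(w) ≤ λ·d(v,w) for all distinct v,w ∈ S. -/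
/-- The weights of the alternating walks `s 0, t 0, s 1, t 1, …, s k` from `r` to `v` in the
parametric graph `G(λ)`. -/
def alternatingWalkWeights {S : Type*} [MetricSpace S] (lam : ℝ) (r v : S) : Set ℝ :=
  {x | ∃ (k : ℕ) (s t : ℕ → S), s 0 = r ∧ s k = v ∧ (∀ j < k, s j ≠ t j) ∧
    x = ∑ j ∈ Finset.range k, (lam * dist (s j) (t j) - dist (t j) (s (j + 1)))}

namespace alternatingWalkWeights

variable {S : Type*} [MetricSpace S] {lam : ℝ} {r v : S} {x : ℝ}

theorem zero_mem : (0 : ℝ) ∈ alternatingWalkWeights lam r r :=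
  ⟨0, fun _ => r, fun _ => r, rfl, rfl, by simp, by simp⟩

theorem add_mem (hx : x ∈ alternatingWalkWeights lam r v) {u : S} (hu : v ≠ u) (w : S) :
    x + (lam * dist v u - dist u w) ∈ alternatingWalkWeights lam r w := by
  obtain ⟨k, s, t, h0, hk, hne, rfl⟩ := hx
  refine ⟨k + 1, fun j => if j ≤ k then s j else w, fun j => if j < k then t j else u,
    by simpa using h0, by simp, fun j hj => ?_, ?_⟩
  · rcases Nat.lt_succ_iff_lt_or_eq.1 hj with h | rfl
    · simpa [h, h.le] using hne j h
    · simpa [hk] using hu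
  · rw [Finset.sum_range_succ]
    congr 1
    · refine Finset.sum_congr rfl fun j hj => ?_
      have h := Finset.mem_range.1 hj
      simp [h, h.le, Nat.succ_le_of_lt h]
    · simp [hk]

theorem nonempty [Nontrivial S] : (alternatingWalkWeights lam r v).Nonempty := by
  obtain ⟨u, hu⟩ := exists_ne r
  exact ⟨_, add_mem zero_mem hu.symm v⟩

theorem nonneg_of_closed
    (hcyc : ∀ k : ℕ, 1 ≤ k → ∀ s t : ℕ → S, (∀ j < k, s j ≠ t j) →
      0 ≤ ∑ j ∈ Finset.range k,
          (lam * dist (s j) (t j) - dist (t j) (s ((j + 1) % k))))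
    (hx : x ∈ alternatingWalkWeights lam r r) : 0 ≤ x := by
  obtain ⟨k, s, t, h0, hk, hne, rfl⟩ := hx
  rcases Nat.eq_zero_or_pos k with rfl | hpos
  · simp
  · refine (hcyc k hpos s t hne).trans_eq (Finset.sum_congr rfl fun j hj => ?_)
    rcases (Nat.succ_le_of_lt (Finset.mem_range.1 hj)).lt_or_eq with h | h
    · rw [Nat.mod_eq_of_lt h]
    · rw [show j + 1 = k from h, Nat.mod_self, h0, hk]

theorem bddBelow [Nontrivial S]
    (hcyc : ∀ k : ℕ, 1 ≤ k → ∀ s t : ℕ → S, (∀ j < k, s j ≠ t j) →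
      0 ≤ ∑ j ∈ Finset.range k,
          (lam * dist (s j) (t j) - dist (t j) (s ((j + 1) % k)))) :
    BddBelow (alternatingWalkWeights lam r v) := by
  obtain ⟨u, hu⟩ := exists_ne v
  refine ⟨-(lam * dist v u - dist u r), fun x hx => ?_⟩
  linarith [nonneg_of_closed hcyc (add_mem hx hu.symm r)]

end alternatingWalkWeights

/-- If `G(λ)` has no negative cycle then it has a feasible potential, `p` on the upper copy of `S`
and `q` on the lower copy. -/
theorem exists_potential_of_no_negative_cycle
    {S : Type*} [MetricSpace S] [Nontrivial S] {lam : ℝ}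
    (hcyc : ∀ k : ℕ, 1 ≤ k → ∀ s t : ℕ → S, (∀ j < k, s j ≠ t j) →
      0 ≤ ∑ j ∈ Finset.range k,
          (lam * dist (s j) (t j) - dist (t j) (s ((j + 1) % k)))) :
    ∃ p q : S → ℝ, (∀ v w, p w + dist v w ≤ q v) ∧
      ∀ v w, v ≠ w → q w ≤ p v + lam * dist v w := by
  obtain ⟨r⟩ : Nonempty S := inferInstance
  let p : S → ℝ := fun v => sInf (alternatingWalkWeights lam r v)
  have hp : ∀ v u w, v ≠ u → p w + dist u w ≤ p v + lam * dist v u := by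
    intro v u w hvu
    have : p w + dist u w - lam * dist v u ≤ p v :=
      le_csInf alternatingWalkWeights.nonempty fun x hx => by
        have := csInf_le (alternatingWalkWeights.bddBelow hcyc)
          (alternatingWalkWeights.add_mem hx hvu w)
        change p w ≤ _ at this
        linarith
    linarith
  refine ⟨p, fun u => ⨅ v : {v // v ≠ u}, (p v + lam * dist (v : S) u), fun u w => ?_,
    fun v u hvu => ?_⟩
  · have : Nonempty {v // v ≠ u} := (exists_ne u).elim fun v hv => ⟨⟨v, hv⟩⟩
    exact le_ciInf fun v => hp v u w v.2
  · exact ciInf_le (f := fun v : {v // v ≠ u} => p v + lam * dist (v : S) u)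
      ⟨p u + dist u u, by rintro _ ⟨v, rfl⟩; exact hp v u u v.2⟩ ⟨v, hvu⟩

/-- If the parametric graph `G(λ)` has no negative-weight cycle — i.e. every
alternating cycle weight `∑ (λ·d(s_j,t_j) − d(t_j,s_{j+1}))` (indices mod `k`,
`s_j ≠ t_j` since `λ`-edges join distinct points) is nonnegative — then the
star-dilation linear program with parameter `λ` is feasible. -/
theorem no_negative_cycle_implies_star_lp_feasible
    {S : Type*} [Fintype S] [MetricSpace S] [Nontrivial S]
    (lam : ℝ)
    (hcyc : ∀ k : ℕ, 1 ≤ k → ∀ s t : ℕ → S, (∀ j < k, s j ≠ t j) →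
      0 ≤ ∑ j ∈ Finset.range k,
          (lam * dist (s j) (t j) - dist (t j) (s ((j + 1) % k)))) :
    ∃ c : S → ℝ, (∀ v : S, 0 ≤ c v) ∧
      ∀ v w : S, v ≠ w → dist v w ≤ c v + c w ∧ c v + c w ≤ lam * dist v w := by
  obtain ⟨p, q, hpq, hqp⟩ := exists_potential_of_no_negative_cycle hcyc
  refine ⟨fun v => (q v - p v) / 2, fun v => ?_, fun v w hvw => ⟨?_, ?_⟩⟩
  · have := hpq v v
    rw [dist_self] at this
    linarith
  · have := hpq w v
    rw [dist_comm] at this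
    linarith [hpq v w]
  · have := hqp w v hvw.symm
    rw [dist_comm] at this
    linarith [hqp v w hvw]
end

section
/- Let (S,d) be a finite metric space with at least two points and let λ ≥ 1 be a real number. Then the following are equivalent: (1) there exists a function c : S → ℝ with c(v) ≥ 0 for all v ∈ S and d(v,w) ≤ c(v) + c(w) ≤ λ·d(v,w) for all distinct v,w ∈ S; (2) for every k ≥ 1 and every sequence of points s_1, t_1, …, s_k, t_k in S (with s_{k+1} = s_1), the alternating cycle weight ∑_{j=1}^{k} ( λ·d(s_j, t_j) − d(t_j, s_{j+1}) ) is nonnegative. -/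
/-- `IsWalkWeight a b r v x` says that `x` is the total weight of a walk from `r` to `v`, each step
of which leaves a point `s` along an `a`-edge to some `t ≠ s` and then follows a `b`-edge. -/
def IsWalkWeight {S : Type*} (a b : S → S → ℝ) (r v : S) (x : ℝ) : Prop :=
  ∃ (k : ℕ) (s t : ℕ → S), s 0 = r ∧ s k = v ∧ (∀ j < k, s j ≠ t j) ∧
    x = ∑ j ∈ Finset.range k, (a (s j) (t j) - b (t j) (s (j + 1)))

namespace IsWalkWeight

variable {S : Type*} {a b : S → S → ℝ} {r u v w : S} {x : ℝ}

theorem refl (a b : S → S → ℝ) (r : S) : IsWalkWeight a b r r 0 :=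
  ⟨0, fun _ => r, fun _ => r, by simp⟩

theorem step (h : IsWalkWeight a b r u x) (hw : u ≠ w) (v : S) :
    IsWalkWeight a b r v (x + (a u w - b w v)) := by
  obtain ⟨k, s, t, h0, hk, hne, rfl⟩ := h
  refine ⟨k + 1, fun j => if j ≤ k then s j else v, fun j => if j < k then t j else w,
    by simpa using h0, by simp, fun j hj => ?_, ?_⟩
  · rcases Nat.lt_succ_iff_lt_or_eq.mp hj with hj | rfl
    · simpa [hj, hj.le] using hne j hj
    · simpa [hk] using hw
  · rw [Finset.sum_range_succ]
    congr 1
    · refine Finset.sum_congr rfl fun j hj => ?_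
      have hj := Finset.mem_range.mp hj
      simp [hj, hj.le, Nat.succ_le_of_lt hj]
    · simp [hk]

theorem nonneg_of_closed
    (hcyc : ∀ k : ℕ, 1 ≤ k → ∀ s t : ℕ → S, (∀ j < k, s j ≠ t j) →
      0 ≤ ∑ j ∈ Finset.range k, (a (s j) (t j) - b (t j) (s ((j + 1) % k))))
    (h : IsWalkWeight a b r r x) : 0 ≤ x := by
  obtain ⟨k, s, t, h0, hk, hne, rfl⟩ := h
  rcases Nat.eq_zero_or_pos k with rfl | hpos
  · simp
  refine (hcyc k hpos s t hne).trans_eq (Finset.sum_congr rfl fun j hj => ?_)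
  rcases (Nat.succ_le_of_lt (Finset.mem_range.mp hj)).lt_or_eq with hj | hj
  · rw [Nat.mod_eq_of_lt hj]
  · rw [show j + 1 = k from hj, Nat.mod_self, h0, hk]

end IsWalkWeight

/-- If no alternating cycle has negative weight, the bipartite graph has a feasible potential:
`p` on the tails of the `a`-edges and `q` on the tails of the `b`-edges. -/
theorem exists_potential_of_cycle_nonneg {S : Type*} [Finite S] [Nontrivial S] {a b : S → S → ℝ}
    (hcyc : ∀ k : ℕ, 1 ≤ k → ∀ s t : ℕ → S, (∀ j < k, s j ≠ t j) →
      0 ≤ ∑ j ∈ Finset.range k, (a (s j) (t j) - b (t j) (s ((j + 1) % k)))) :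
    ∃ p q : S → ℝ, (∀ u w, u ≠ w → q w ≤ p u + a u w) ∧ ∀ w v, p v ≤ q w - b w v := by
  obtain ⟨r⟩ : Nonempty S := inferInstance
  have hbdd (v : S) : BddBelow {x | IsWalkWeight a b r v x} := by
    obtain ⟨w, hw⟩ := exists_ne v
    refine ⟨-(a v w - b w r), fun x hx => ?_⟩
    linarith [(IsWalkWeight.step hx hw.symm r).nonneg_of_closed hcyc]
  have hnonempty (v : S) : {x | IsWalkWeight a b r v x}.Nonempty := by
    obtain ⟨w, hw⟩ := exists_ne r
    exact ⟨_, (IsWalkWeight.refl a b r).step hw.symm v⟩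
  let p : S → ℝ := fun v => sInf {x | IsWalkWeight a b r v x}
  have hstep (u w v : S) (hw : u ≠ w) : p v ≤ p u + (a u w - b w v) := by
    rw [← sub_le_iff_le_add]
    refine le_csInf (hnonempty u) fun x hx => ?_
    rw [sub_le_iff_le_add]
    exact csInf_le (hbdd v) (IsWalkWeight.step hx hw v)
  refine ⟨p, fun w => ⨅ u : {u // u ≠ w}, (p u + a u w), fun u w hw => ?_, fun w v => ?_⟩
  · exact ciInf_le (Set.finite_range fun u : {u // u ≠ w} => p u + a u w).bddBelow ⟨u, hw⟩
  · obtain ⟨u, hu⟩ := exists_ne w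
    have : Nonempty {u // u ≠ w} := ⟨⟨u, hu⟩⟩
    rw [le_sub_iff_add_le]
    exact le_ciInf fun u => by linarith [hstep u w v u.2]

/-- Feasibility of the star-dilation linear program with parameter `λ ≥ 1` is
equivalent to the absence of negative-weight cycles in the parametric graph
`G(λ)`, i.e. to the nonnegativity of all alternating cycle weights
`∑ (λ·d(s_j,t_j) − d(t_j,s_{j+1}))` (indices mod `k`, `s_j ≠ t_j` since
`λ`-edges join distinct points). -/
theorem star_lp_feasible_iff_no_negative_cycle
    {S : Type*} [Fintype S] [MetricSpace S] [Nontrivial S]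
    (lam : ℝ) (hlam : 1 ≤ lam) :
    (∃ c : S → ℝ, (∀ v : S, 0 ≤ c v) ∧
        ∀ v w : S, v ≠ w → dist v w ≤ c v + c w ∧ c v + c w ≤ lam * dist v w) ↔
    (∀ k : ℕ, 1 ≤ k → ∀ s t : ℕ → S, (∀ j < k, s j ≠ t j) →
      0 ≤ ∑ j ∈ Finset.range k,
          (lam * dist (s j) (t j) - dist (t j) (s ((j + 1) % k)))) := by
  constructor
  · rintro ⟨c, hc, h⟩ k hk s t hne
    have hdist (v w : S) : dist v w ≤ c v + c w := by
      rcases eq_or_ne v w with rfl | hvw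
      · simpa using add_nonneg (hc v) (hc v)
      · exact (h v w hvw).1
    have hshift : ∑ j ∈ Finset.range k, c (s ((j + 1) % k)) = ∑ j ∈ Finset.range k, c (s j) := by
      obtain ⟨n, rfl⟩ := Nat.exists_eq_add_of_le' hk
      rw [Finset.sum_range_succ, Finset.sum_range_succ' (fun j => c (s j)), Nat.mod_self]
      congr 1
      refine Finset.sum_congr rfl fun j hj => ?_
      rw [Nat.mod_eq_of_lt (Nat.succ_lt_succ (Finset.mem_range.mp hj))]
    calc (0 : ℝ) = ∑ j ∈ Finset.range k, (c (s j) - c (s ((j + 1) % k))) := by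
          rw [Finset.sum_sub_distrib, hshift, sub_self]
      _ ≤ _ := Finset.sum_le_sum fun j hj => by
          linarith [(h _ _ (hne j (Finset.mem_range.mp hj))).2, hdist (t j) (s ((j + 1) % k))]
  · intro hcyc
    obtain ⟨p, q, hpq, hqp⟩ :=
      exists_potential_of_cycle_nonneg (a := fun u w => lam * dist u w) (b := dist) hcyc
    refine ⟨fun v => (q v - p v) / 2, fun v => ?_, fun v w hvw => ⟨?_, ?_⟩⟩
    · linarith [hqp v v, dist_self v]
    · linarith [hqp v w, hqp w v, dist_comm v w]
    · have h₁ := hpq v w hvw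
      have h₂ := hpq w v hvw.symm
      rw [dist_comm w v] at h₂
      linarith
end
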